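/- For every complex number q with ‖q‖ < 1, (q;q)_∞³ + 3q·(q⁹;q⁹)_∞³ = (q³;q³)_∞ · ( 1 + 6·Σ_{n≥0} ( q^{9n+3}/(1 − q^{9n+3}) − q^{9n+6}/(1 − q^{9n+6}) ) ). -/

import Mathlib

/-- `(a;q)_∞ = ∏_{j ≥ 0} (1 - a q^j)`. -/
noncomputable def qPochhammerInf (a q : ℂ) : ℂ := ∏' j : ℕ, (1 - a * q ^ j)

open Filter Topology

noncomputable def qf (q : ℂ) (n : ℕ) : ℂ := ∏ j ∈ Finset.range n, (1 - q ^ (j + 1))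

noncomputable def rf (q : ℂ) : ℤ → ℂ
  | Int.ofNat n => (qf q n)⁻¹
  | Int.negSucc _ => 0

theorem one_sub_pow_ne {q : ℂ} (hq : ‖q‖ < 1) (j : ℕ) : 1 - q ^ (j + 1) ≠ 0 := by
  intro h
  have h1 : q ^ (j + 1) = 1 := (sub_eq_zero.mp h).symm
  have h2 : ‖q‖ ^ (j + 1) < 1 := pow_lt_one₀ (norm_nonneg _) hq (by omega)
  rw [← norm_pow, h1] at h2
  simp at h2

theorem qf_ne {q : ℂ} (hq : ‖q‖ < 1) (n : ℕ) : qf q n ≠ 0 :=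
  Finset.prod_ne_zero_iff.mpr fun j _ => one_sub_pow_ne hq j

theorem qf_succ (q : ℂ) (n : ℕ) : qf q (n + 1) = qf q n * (1 - q ^ (n + 1)) :=
  Finset.prod_range_succ _ _

theorem rf_rec {q : ℂ} (hq : ‖q‖ < 1) (m : ℤ) : rf q (m - 1) = rf q m * (1 - q ^ m) := by
  rcases m with n | n
  · rcases n with _ | n
    · simp only [Int.ofNat_eq_natCast, Nat.cast_zero, zpow_zero, sub_self, mul_zero]
      rfl
    · have e : (Int.ofNat (n + 1) - 1 : ℤ) = Int.ofNat n := by simp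
      rw [e]
      simp only [rf]
      have h1 : qf q (n + 1) = qf q n * (1 - q ^ (n + 1)) := Finset.prod_range_succ _ _
      have h2 : q ^ (Int.ofNat (n + 1)) = q ^ (n + 1) := zpow_natCast q (n + 1)
      rw [h1, h2, mul_inv, mul_assoc, inv_mul_cancel₀ (one_sub_pow_ne hq n), mul_one]
  · have e : (Int.negSucc n - 1 : ℤ) = Int.negSucc (n + 1) := by
      simp [Int.negSucc_eq]; ring
    rw [e]
    simp [rf]

theorem rf_of_neg (q : ℂ) {m : ℤ} (hm : m < 0) : rf q m = 0 := by
  rcases m with n | n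
  · exact absurd hm (by simp)
  · rfl

def ee (k : ℤ) : ℤ := k * (k - 1) / 2

theorem two_ee (k : ℤ) : 2 * ee k = k * (k - 1) :=
  Int.mul_ediv_cancel' (by
    have := Int.even_mul_pred_self k
    exact this.two_dvd)

noncomputable def tt (q : ℂ) (k : ℤ) : ℂ := (-1) ^ k * q ^ ee k

noncomputable def aa (q : ℂ) (n : ℕ) (k : ℤ) : ℂ :=
  tt q k * (qf q (2 * n) * rf q (n + k) * rf q (n - k))

theorem tt_succ {q : ℂ} (h0 : q ≠ 0) (k : ℤ) : tt q (k + 1) = - (q ^ k * tt q k) := by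
  have : ee (k + 1) = k + ee k := by
    have h1 := two_ee k
    have h2 := two_ee (k + 1)
    linarith
  unfold tt
  rw [this, zpow_add₀ h0, zpow_add₀ (by norm_num : (-1 : ℂ) ≠ 0)]
  simp
  ring

theorem tt_pred {q : ℂ} (h0 : q ≠ 0) (k : ℤ) : tt q (k - 1) = - (q * q ^ (-k) * tt q k) := by
  have h := tt_succ h0 (k - 1)
  rw [sub_add_cancel] at h
  rw [h, zpow_sub₀ h0, zpow_neg]
  have := zpow_ne_zero k h0
  field_simp

theorem aa_zero {q : ℂ} (k : ℤ) : aa q 0 k = if k = 0 then 1 else 0 := by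
  split_ifs with h
  · subst h
    have : rf q 0 = (qf q 0)⁻¹ := rfl
    simp [aa, tt, ee, qf, this]
  · rcases lt_or_gt_of_ne h with h | h
    · simp [aa, rf_of_neg q h]
    · simp [aa, rf_of_neg q (show -k < 0 by omega)]

theorem aa_rec {q : ℂ} (h0 : q ≠ 0) (hq : ‖q‖ < 1) (n : ℕ) (k : ℤ) :
    aa q (n + 1) k = (1 + q ^ (2 * n + 1)) * aa q n k - q ^ n * aa q n (k - 1)
      - q ^ (n + 1) * aa q n (k + 1) := by
  unfold aa
  rw [tt_succ h0, tt_pred h0]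
  have h1 : qf q (2 * (n + 1)) = qf q (2 * n) * (1 - q ^ (2 * n + 1)) * (1 - q ^ (2 * n + 2)) := by
    rw [show 2 * (n + 1) = 2 * n + 1 + 1 by ring, qf, Finset.prod_range_succ,
      Finset.prod_range_succ]; rfl
  have r1 := rf_rec hq (n + 1 + k)
  have r2 := rf_rec hq (n + k)
  have r3 := rf_rec hq (n + 1 - k)
  have r4 := rf_rec hq (n - k)
  rw [show (n + 1 + k - 1 : ℤ) = n + k by ring] at r1
  rw [show (n + 1 - k - 1 : ℤ) = n - k by ring] at r3
  push_cast
  rw [show (n + (k - 1) : ℤ) = n + k - 1 by ring, show (n - (k - 1) : ℤ) = n + 1 - k by ring,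
    show (n + (k + 1) : ℤ) = n + 1 + k by ring, show (n - (k + 1) : ℤ) = n - k - 1 by ring,
    r2, r4, r1, r3, h1]
  generalize rf q (n + 1 + k) = X
  generalize rf q (n + 1 - k) = Y
  generalize tt q k = T
  generalize qf q (2 * n) = F
  simp only [zpow_add₀ h0, zpow_sub₀ h0, zpow_neg, zpow_natCast, zpow_one, pow_add, pow_mul', pow_one]
  have hB := zpow_ne_zero k h0
  generalize q ^ k = B at *
  generalize q ^ n = A at *
  field_simp
  ring

noncomputable def PP (q z : ℂ) (n : ℕ) : ℂ :=
  ∏ j ∈ Finset.range n, ((1 - z * q ^ j) * (1 - q ^ (j + 1) / z))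

noncomputable def DD (q z : ℂ) : ℕ → ℂ
  | 0 => 0
  | n + 1 => (1 - z * q ^ n) * (1 - q ^ (n + 1) / z) * DD q z n +
      (-(z * q ^ n) * (1 - q ^ (n + 1) / z) + (1 - z * q ^ n) * (q ^ (n + 1) / z)) * PP q z n

theorem hasSum_PD {q z : ℂ} (h0 : q ≠ 0) (hq : ‖q‖ < 1) (hz : z ≠ 0) (n : ℕ) :
    HasSum (fun k : ℤ => aa q n k * z ^ k) (PP q z n) ∧
    HasSum (fun k : ℤ => k * (aa q n k * z ^ k)) (DD q z n) := by
  induction n with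
  | zero =>
    simp only [aa_zero, PP, DD, Finset.range_zero, Finset.prod_empty]
    constructor
    · convert hasSum_ite_eq (0 : ℤ) (1 : ℂ) using 2 with k
      split_ifs with h <;> simp [h]
    · convert hasSum_zero using 2 with k
      split_ifs with h <;> simp [h]
  | succ n ih =>
    obtain ⟨hP, hD⟩ := ih
    have hP1 := (Equiv.subRight (1 : ℤ)).hasSum_iff.mpr hP
    have hP2 := (Equiv.addRight (1 : ℤ)).hasSum_iff.mpr hP
    have hD1 := (Equiv.subRight (1 : ℤ)).hasSum_iff.mpr hD
    have hD2 := (Equiv.addRight (1 : ℤ)).hasSum_iff.mpr hD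
    constructor
    · convert ((hP.mul_left (1 + q ^ (2 * n + 1))).sub (hP1.mul_left (q ^ n * z))).sub
        (hP2.mul_left (q ^ (n + 1) / z)) using 1
      · rfl
      · funext k
        simp only [Function.comp, Equiv.subRight_apply, Equiv.coe_addRight]
        rw [aa_rec h0 hq, zpow_add₀ hz, zpow_sub₀ hz]
        field_simp
      · rw [PP, Finset.prod_range_succ, ← PP]
        field_simp
        ring
    · convert ((hD.mul_left (1 + q ^ (2 * n + 1))).sub ((hD1.add hP1).mul_left (q ^ n * z))).sub
        ((hD2.sub hP2).mul_left (q ^ (n + 1) / z)) using 1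
      · rfl
      · funext k
        simp only [Function.comp, Equiv.subRight_apply, Equiv.coe_addRight]
        rw [aa_rec h0 hq, zpow_add₀ hz, zpow_sub₀ hz]
        push_cast
        field_simp
        ring
      · rw [DD]
        field_simp
        ring

theorem summable_pow_succ {q : ℂ} (hq : ‖q‖ < 1) : Summable fun n : ℕ => ‖-q ^ (n + 1)‖ := by
  simpa using (summable_nat_add_iff 1).mpr (summable_geometric_of_lt_one (norm_nonneg _) hq)

theorem poch_eq (q : ℂ) : qPochhammerInf q q = ∏' n : ℕ, (1 - q ^ (n + 1)) := by
  unfold qPochhammerInf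
  congr 1
  funext n
  rw [pow_succ']

theorem poch_ne {q : ℂ} (hq : ‖q‖ < 1) : qPochhammerInf q q ≠ 0 := by
  rw [poch_eq]
  refine tprod_one_add_ne_zero_of_summable (f := fun n : ℕ => -q ^ (n + 1)) ?_ ?_
  · intro i
    simpa [sub_eq_add_neg] using one_sub_pow_ne hq i
  · exact summable_pow_succ hq

theorem qf_tendsto {q : ℂ} (hq : ‖q‖ < 1) :
    Tendsto (qf q) atTop (𝓝 (qPochhammerInf q q)) := by
  rw [poch_eq]
  have h : Multipliable fun n : ℕ => 1 - q ^ (n + 1) :=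
    multipliable_one_add_of_summable (f := fun n : ℕ => -q ^ (n + 1)) (summable_pow_succ hq)
  exact h.tendsto_prod_tprod_nat

theorem rf_tendsto {q : ℂ} (hq : ‖q‖ < 1) :
    Tendsto (rf q) atTop (𝓝 (qPochhammerInf q q)⁻¹) := by
  have h1 := (qf_tendsto hq).inv₀ (poch_ne hq)
  have h2 : Tendsto Int.toNat atTop atTop := by
    refine tendsto_atTop.mpr fun n => ?_
    filter_upwards [eventually_ge_atTop (n : ℤ)] with m hm
    omega
  refine (h1.comp h2).congr' ?_
  filter_upwards [eventually_ge_atTop (0 : ℤ)] with m hm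
  obtain ⟨n, rfl⟩ := Int.eq_ofNat_of_zero_le hm
  rfl

theorem bdd_of_tendsto {u : ℕ → ℂ} {l : ℂ} (h : Tendsto u atTop (𝓝 l)) :
    ∃ C : ℝ, 0 ≤ C ∧ ∀ n, ‖u n‖ ≤ C := by
  obtain ⟨C, hC⟩ := h.norm.bddAbove_range
  exact ⟨C, (norm_nonneg _).trans (hC ⟨0, rfl⟩), fun n => hC ⟨n, rfl⟩⟩

theorem main_limit {q : ℂ} (hq : ‖q‖ < 1) (w : ℤ → ℂ)
    (hw : Summable fun k : ℤ => ‖w k * tt q k‖) :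
    Tendsto (fun n : ℕ => ∑' k : ℤ, w k * aa q n k) atTop
      (𝓝 ((∑' k : ℤ, w k * tt q k) * (qPochhammerInf q q)⁻¹)) := by
  have hE := poch_ne hq
  obtain ⟨C, hC0, hC⟩ := bdd_of_tendsto (qf_tendsto hq)
  obtain ⟨B, hB0, hB⟩ := bdd_of_tendsto ((qf_tendsto hq).inv₀ hE)
  have hr : ∀ m, ‖rf q m‖ ≤ B := by
    intro m
    rcases m with n | n
    · exact hB n
    · simpa [rf] using hB0
  rw [← tsum_mul_right]
  refine tendsto_tsum_of_dominated_convergence (bound := fun k => ‖w k * tt q k‖ * (C * B * B))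
    (hw.mul_right _) ?_ ?_
  · intro k
    have e : w k * tt q k * (qPochhammerInf q q)⁻¹ = w k * (tt q k *
        (qPochhammerInf q q * (qPochhammerInf q q)⁻¹ * (qPochhammerInf q q)⁻¹)) := by
      field_simp
    rw [e]
    unfold aa
    refine Tendsto.const_mul _ (Tendsto.const_mul _ (Tendsto.mul (Tendsto.mul ?_ ?_) ?_))
    · exact (qf_tendsto hq).comp (tendsto_id.const_mul_atTop' (by norm_num))
    · exact (rf_tendsto hq).comp
        (tendsto_atTop_add_const_right _ _ tendsto_natCast_atTop_atTop)
    · exact (rf_tendsto hq).comp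
        (tendsto_atTop_add_const_right _ (-k) tendsto_natCast_atTop_atTop)
  · refine Eventually.of_forall fun n k => ?_
    unfold aa
    rw [← mul_assoc, norm_mul, norm_mul (_ * _), norm_mul (qf _ _)]
    gcongr
    · exact hC _
    · exact hr _
    · exact hr _

theorem summable_bound {r : ℝ} (h0 : 0 < r) (h1 : r < 1) (e : ℤ → ℤ) (he : ∀ k, |k| - 1 ≤ e k) :
    Summable (fun k : ℤ => (|k| : ℝ) * r ^ e k) ∧ Summable (fun k : ℤ => r ^ e k) := by
  have key : ∀ k, r ^ e k ≤ r⁻¹ * r ^ k.natAbs := by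
    intro k
    have : r ^ e k ≤ r ^ (|k| - 1) := (zpow_le_zpow_iff_right_of_lt_one₀ h0 h1).mpr (he k)
    refine this.trans (le_of_eq ?_)
    rw [zpow_sub₀ h0.ne', zpow_one, Int.abs_eq_natAbs, zpow_natCast]
    field_simp
  have hn : ‖r‖ < 1 := by rwa [Real.norm_of_nonneg h0.le]
  have s1 : Summable fun n : ℕ => (n : ℝ) * r ^ n := by
    simpa using summable_pow_mul_geometric_of_norm_lt_one 1 hn
  have s0 : Summable fun n : ℕ => r ^ n := summable_geometric_of_lt_one h0.le h1
  have t1 : Summable fun k : ℤ => (k.natAbs : ℝ) * r ^ k.natAbs :=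
    Summable.of_nat_of_neg (by simpa using s1) (by simpa using s1)
  have t0 : Summable fun k : ℤ => r ^ k.natAbs :=
    Summable.of_nat_of_neg (by simpa using s0) (by simpa using s0)
  constructor
  · refine Summable.of_nonneg_of_le (fun k => by positivity) (fun k => ?_) (t1.mul_left r⁻¹)
    have := mul_le_mul_of_nonneg_left (key k) (abs_nonneg (k : ℝ))
    refine this.trans (le_of_eq ?_)
    rw [Nat.cast_natAbs, Int.cast_abs]
    ring
  · exact Summable.of_nonneg_of_le (fun k => by positivity) key (t0.mul_left r⁻¹)

theorem ee_ge (k : ℤ) : |k| - 1 ≤ ee k := by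
  have h := two_ee k
  rcases abs_cases k with ⟨h1, h2⟩ | ⟨h1, h2⟩ <;> rw [h1]
  · rcases (by omega : k ≤ 1 ∨ 2 ≤ k) with h3 | h3
    · nlinarith
    · nlinarith
  · nlinarith

theorem jac_summable {q : ℂ} (h0 : q ≠ 0) (hq : ‖q‖ < 1) :
    (Summable fun k : ℤ => ‖(k : ℂ) * tt q k‖) ∧ Summable fun k : ℤ => ‖(1 : ℂ) * tt q k‖ := by
  have := summable_bound (norm_pos_iff.mpr h0) hq ee ee_ge
  simpa [tt] using this

/-- Jacobi identity for the cube. -/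
theorem jac_cube {q : ℂ} (h0 : q ≠ 0) (hq : ‖q‖ < 1) :
    ∑' k : ℤ, (k : ℂ) * tt q k = - qPochhammerInf q q ^ 3 ∧ ∑' k : ℤ, tt q k = 0 := by
  obtain ⟨s1, s0⟩ := jac_summable h0 hq
  have hE := poch_ne hq
  have l1 := main_limit hq _ s1
  have l0 := main_limit hq _ s0
  have hP : ∀ n, PP q 1 (n + 1) = 0 := by
    intro n
    refine Finset.prod_eq_zero (i := 0) (by simp) (by simp)
  have hD : ∀ n, DD q 1 (n + 1) = -(qf q n * qf q (n + 1)) := by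
    intro n
    induction n with
    | zero => simp [DD, PP, qf]
    | succ n ih =>
      rw [DD, ih, hP, qf_succ q n, qf_succ q (n + 1), qf_succ q n]
      ring
  have hs := fun n => hasSum_PD h0 hq one_ne_zero n (z := 1)
  simp only [one_zpow, mul_one] at hs
  constructor
  · have l2 : Tendsto (fun n : ℕ => -(qf q n * qf q (n + 1))) atTop
        (𝓝 (-(qPochhammerInf q q * qPochhammerInf q q))) :=
      ((qf_tendsto hq).mul ((tendsto_add_atTop_iff_nat 1).mpr (qf_tendsto hq))).neg
    have l3 := (tendsto_add_atTop_iff_nat 1).mpr l1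
    have := tendsto_nhds_unique (l3.congr fun n => by rw [(hs (n + 1)).2.tsum_eq, hD]) l2
    field_simp at this
    rw [this]
  · have l3 := (tendsto_add_atTop_iff_nat 1).mpr l0
    have := tendsto_nhds_unique (l3.congr (f₂ := fun n => (0 : ℂ)) fun n => by
      simp only [one_mul]
      rw [(hs (n + 1)).1.tsum_eq, hP]) tendsto_const_nhds
    simpa [hE] using this

def gg (k : ℤ) : ℤ := 3 * ee k + 2 * k

theorem gg_ge (k : ℤ) : |k| - 1 ≤ gg k := by
  have h := two_ee k
  unfold gg
  rcases abs_cases k with ⟨h1, h2⟩ | ⟨h1, h2⟩ <;> rw [h1] <;>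
    nlinarith [sq_nonneg (k - 1), sq_nonneg k]

noncomputable def uu (Q : ℂ) (k : ℤ) : ℂ := (-1) ^ k * Q ^ gg k

theorem uu_eq {Q : ℂ} (h0 : Q ≠ 0) (k : ℤ) : (Q ^ 2) ^ k * tt (Q ^ 3) k = uu Q k := by
  unfold uu tt gg
  rw [zpow_add₀ h0, zpow_mul, zpow_mul]
  norm_cast
  ring

theorem DD_eq {q z : ℂ} (n : ℕ) (h1 : ∀ j : ℕ, 1 - z * q ^ j ≠ 0)
    (h2 : ∀ j : ℕ, 1 - q ^ (j + 1) / z ≠ 0) :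
    DD q z n = PP q z n * ∑ j ∈ Finset.range n,
      ((q ^ (j + 1) / z) / (1 - q ^ (j + 1) / z) - z * q ^ j / (1 - z * q ^ j)) := by
  induction n with
  | zero => simp [DD]
  | succ n ih =>
    rw [DD, ih, Finset.sum_range_succ, PP, PP, Finset.prod_range_succ]
    have a1 := h1 n
    have a2 := h2 n
    generalize q ^ (n + 1) / z = A at *
    generalize z * q ^ n = B at *
    field_simp
    ring

theorem lambert_summable {Q : ℂ} (hQ : ‖Q‖ < 1) :
    Summable fun n : ℕ => Q ^ (3 * n + 1) / (1 - Q ^ (3 * n + 1)) -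
      Q ^ (3 * n + 2) / (1 - Q ^ (3 * n + 2)) := by
  have h : Summable fun n : ℕ => Q ^ n / (1 - Q ^ n) := by
    simpa using summable_norm_pow_mul_geometric_div_one_sub 0 hQ
  exact (h.comp_injective (i := fun n : ℕ => 3 * n + 1) fun a b hab => by
    simp only at hab; omega).sub (h.comp_injective (i := fun n : ℕ => 3 * n + 2) fun a b hab => by
    simp only at hab; omega)

theorem uu_summable {Q : ℂ} (h0 : Q ≠ 0) (hQ : ‖Q‖ < 1) :
    (Summable fun k : ℤ => ‖(k : ℂ) * uu Q k‖) ∧ Summable fun k : ℤ => ‖uu Q k‖ := by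
  have := summable_bound (norm_pos_iff.mpr h0) hQ gg gg_ge
  simpa [uu] using this

theorem part_two {Q : ℂ} (h0 : Q ≠ 0) (hQ : ‖Q‖ < 1) :
    ∑' k : ℤ, uu Q k = qPochhammerInf Q Q ∧
    ∑' k : ℤ, (k : ℂ) * uu Q k = qPochhammerInf Q Q *
      ∑' n : ℕ, (Q ^ (3 * n + 1) / (1 - Q ^ (3 * n + 1)) -
        Q ^ (3 * n + 2) / (1 - Q ^ (3 * n + 2))) := by
  have h30 : Q ^ 3 ≠ 0 := pow_ne_zero 3 h0
  have h20 : Q ^ 2 ≠ 0 := pow_ne_zero 2 h0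
  have hp : ‖Q ^ 3‖ < 1 := by
    rw [norm_pow]
    exact pow_lt_one₀ (norm_nonneg _) hQ (by norm_num)
  obtain ⟨s1, s0⟩ := uu_summable h0 hQ
  have e0 : ∀ k : ℤ, (Q ^ 2) ^ k * tt (Q ^ 3) k = uu Q k := uu_eq h0
  have e1 : ∀ k : ℤ, (k * (Q ^ 2) ^ k) * tt (Q ^ 3) k = k * uu Q k := fun k => by
    rw [mul_assoc, e0]
  have l0 := main_limit hp (fun k => (Q ^ 2) ^ k) (by simpa only [e0] using s0)
  have l1 := main_limit hp (fun k => k * (Q ^ 2) ^ k) (by simpa only [e1] using s1)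
  simp only [e0] at l0
  simp only [e1] at l1
  have hE := poch_ne hp
  have hs := fun n => hasSum_PD h30 hp h20 n
  have b1 : ∀ j : ℕ, Q ^ 2 * (Q ^ 3) ^ j = Q ^ (3 * j + 2) := fun j => by
    rw [← pow_mul, ← pow_add, add_comm]
  have b2 : ∀ j : ℕ, (Q ^ 3) ^ (j + 1) / Q ^ 2 = Q ^ (3 * j + 1) := fun j => by
    rw [← pow_mul, div_eq_iff h20, ← pow_add]
    ring_nf
  have hPP : ∀ n, PP (Q ^ 3) (Q ^ 2) n * qf (Q ^ 3) n = qf Q (3 * n) := by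
    intro n
    induction n with
    | zero => simp [PP, qf]
    | succ n ih =>
      rw [PP, Finset.prod_range_succ, ← PP, qf_succ, b1, b2,
        show 3 * (n + 1) = 3 * n + 1 + 1 + 1 by ring, qf_succ, qf_succ, qf_succ, ← ih, ← pow_mul]
      ring_nf
  have lP : Tendsto (PP (Q ^ 3) (Q ^ 2)) atTop
      (𝓝 (qPochhammerInf Q Q * (qPochhammerInf (Q ^ 3) (Q ^ 3))⁻¹)) := by
    have := ((qf_tendsto hQ).comp (tendsto_id.const_mul_atTop' (by norm_num : 0 < 3))).mul
      ((qf_tendsto hp).inv₀ hE)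
    refine this.congr fun n => ?_
    simp only [Function.comp, id]
    rw [← hPP, mul_assoc, mul_inv_cancel₀ (qf_ne hp n), mul_one]
  constructor
  · have := tendsto_nhds_unique (l0.congr fun n => by
      rw [← (hs n).1.tsum_eq]; simp only [mul_comm]) lP
    exact mul_right_cancel₀ (inv_ne_zero hE) this
  · have lS := (lambert_summable hQ).tendsto_sum_tsum_nat
    have := tendsto_nhds_unique (l1.congr fun n => by
      have e : ∑' k : ℤ, (k * (Q ^ 2) ^ k) * aa (Q ^ 3) n k = DD (Q ^ 3) (Q ^ 2) n := by
        rw [← (hs n).2.tsum_eq]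
        congr 1
        funext k
        ring
      rw [e, DD_eq n (fun j => by rw [b1]; exact one_sub_pow_ne hQ _)
        (fun j => by rw [b2]; exact one_sub_pow_ne hQ _)]
      simp only [b1, b2]) (lP.mul lS)
    refine mul_right_cancel₀ (inv_ne_zero hE) (this.trans ?_)
    ring

theorem split_three {f : ℤ → ℂ} (hf : Summable f) :
    ∑' k, f k = ∑' m, f (3 * m) + ∑' m, f (3 * m + 1) + ∑' m, f (3 * m + 2) := by
  have i0 : Function.Injective fun m : ℤ => 3 * m := fun a b h => by simp only at h; omega
  have i1 : Function.Injective fun m : ℤ => 3 * m + 1 := fun a b h => by simp only at h; omega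
  have i2 : Function.Injective fun m : ℤ => 3 * m + 2 := fun a b h => by simp only at h; omega
  have s0 : Summable fun m : ℤ => f (3 * m) := hf.comp_injective i0
  have s1 : Summable fun m : ℤ => f (3 * m + 1) := hf.comp_injective i1
  have s2 : Summable fun m : ℤ => f (3 * m + 2) := hf.comp_injective i2
  have hf' := (Int.divModEquiv 3).symm.summable_iff.mpr hf
  rw [← (Int.divModEquiv 3).symm.tsum_eq f]
  refine hf'.tsum_prod.trans ?_
  simp only [tsum_fintype, Fin.sum_univ_three]
  rw [← s0.tsum_add s1, ← (s0.add s1).tsum_add s2]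
  congr 1
  funext m
  simp [Int.divModEquiv, mul_comm]

theorem tt_a {q : ℂ} (h0 : q ≠ 0) (m : ℤ) : tt q (3 * (-m)) = uu (q ^ 3) m := by
  have e : ee (3 * (-m)) = 3 * gg m := by
    have h1 := two_ee (3 * (-m))
    have h2 := two_ee m
    unfold gg
    linarith
  have h2 : (-1 : ℂ) ^ (3 * (-m)) = (-1) ^ m := by
    rw [zpow_mul, zpow_neg, ← inv_zpow]
    norm_num
  unfold tt uu
  rw [e, zpow_mul q, h2]
  norm_cast

theorem tt_b {q : ℂ} (h0 : q ≠ 0) (m : ℤ) : tt q (3 * m + 1) = - uu (q ^ 3) m := by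
  have e : ee (3 * m + 1) = 3 * gg m := by
    have h1 := two_ee (3 * m + 1)
    have h2 := two_ee m
    unfold gg
    linarith
  unfold tt uu
  rw [e, zpow_mul q, zpow_add₀ (by norm_num), zpow_mul (-1 : ℂ)]
  norm_num

theorem tt_c {q : ℂ} (h0 : q ≠ 0) (m : ℤ) : tt q (3 * (m - 1) + 2) = - (q * tt (q ^ 9) m) := by
  have e : ee (3 * (m - 1) + 2) = 9 * ee m + 1 := by
    have h1 := two_ee (3 * (m - 1) + 2)
    have h2 := two_ee m
    linarith
  have h2 : (-1 : ℂ) ^ (3 * (m - 1) + 2) = -(-1) ^ m := by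
    rw [zpow_add₀ (by norm_num), zpow_mul (-1 : ℂ), zpow_sub₀ (by norm_num)]
    norm_num [div_neg]
  have h3 : q ^ (9 * ee m + 1) = (q ^ 9) ^ ee m * q := by
    rw [zpow_add₀ h0, zpow_mul q, zpow_one]
    norm_cast
  unfold tt
  rw [e, h2, h3]
  ring

theorem cubic_theta_addition (q : ℂ) (hq : ‖q‖ < 1) :
    (qPochhammerInf q q) ^ 3 + 3 * q * (qPochhammerInf (q ^ 9) (q ^ 9)) ^ 3 =
      qPochhammerInf (q ^ 3) (q ^ 3) *
        (1 + 6 * ∑' n : ℕ,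
          (q ^ (9 * n + 3) / (1 - q ^ (9 * n + 3)) -
            q ^ (9 * n + 6) / (1 - q ^ (9 * n + 6)))) := by
  rcases eq_or_ne q 0 with rfl | h0
  · simp [qPochhammerInf]
  have h3 : ‖q ^ 3‖ < 1 := by
    rw [norm_pow]; exact pow_lt_one₀ (norm_nonneg _) hq (by norm_num)
  have h9 : ‖q ^ 9‖ < 1 := by
    rw [norm_pow]; exact pow_lt_one₀ (norm_nonneg _) hq (by norm_num)
  obtain ⟨p0, p1⟩ := part_two (pow_ne_zero 3 h0) h3
  obtain ⟨u1, u0⟩ := uu_summable (pow_ne_zero 3 h0) h3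
  obtain ⟨j1, j0⟩ := jac_cube (pow_ne_zero 9 h0) h9
  obtain ⟨v1, v0⟩ := jac_summable (pow_ne_zero 9 h0) h9
  have c1 := (jac_cube h0 hq).1
  have hA : ∑' m : ℤ, ((3 * m : ℤ) : ℂ) * tt q (3 * m) = -3 * ∑' m : ℤ, m * uu (q ^ 3) m := by
    rw [← (Equiv.neg ℤ).tsum_eq, ← tsum_mul_left]
    congr 1
    funext m
    simp only [Equiv.neg_apply]
    rw [tt_a h0]
    push_cast
    ring
  have hB : ∑' m : ℤ, ((3 * m + 1 : ℤ) : ℂ) * tt q (3 * m + 1) =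
      -3 * ∑' m : ℤ, m * uu (q ^ 3) m - ∑' m : ℤ, uu (q ^ 3) m := by
    rw [← tsum_mul_left, ← (u1.of_norm.mul_left _).tsum_sub u0.of_norm]
    congr 1
    funext m
    rw [tt_b h0]
    push_cast
    ring
  have hC : ∑' m : ℤ, ((3 * m + 2 : ℤ) : ℂ) * tt q (3 * m + 2) =
      -3 * q * ∑' m : ℤ, m * tt (q ^ 9) m + q * ∑' m : ℤ, tt (q ^ 9) m := by
    simp only [one_mul] at v0
    rw [← (Equiv.subRight (1 : ℤ)).tsum_eq, ← tsum_mul_left, ← tsum_mul_left,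
      ← (v1.of_norm.mul_left _).tsum_add (v0.of_norm.mul_left _)]
    congr 1
    funext m
    simp only [Equiv.subRight_apply]
    rw [tt_c h0]
    push_cast
    ring
  rw [split_three (jac_summable h0 hq).1.of_norm, hA, hB, hC, p0, p1, j0, j1] at c1
  have eS : ∀ n : ℕ, (q ^ 3) ^ (3 * n + 1) / (1 - (q ^ 3) ^ (3 * n + 1)) -
        (q ^ 3) ^ (3 * n + 2) / (1 - (q ^ 3) ^ (3 * n + 2)) =
      q ^ (9 * n + 3) / (1 - q ^ (9 * n + 3)) - q ^ (9 * n + 6) / (1 - q ^ (9 * n + 6)) := by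
    intro n
    rw [← pow_mul, ← pow_mul]
    ring_nf
  simp only [eS] at c1
  linear_combination c1
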